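/- arXiv:math/9803081 — 7 statements merged into one kernel-verified Lean document; each statement's English description precedes it below -/
import Mathlib

section
/- Let M be a matrix in SL(2,ℤ) with trace 3. Then M cannot be written as a product M = A·B of two unipotent matrices A, B ∈ SL(2,ℤ) that are conjugate to each other in SL(2,ℤ). (This is the property of the monodromy matrix of the figure eight knot used in the paper to show that the figure eight knot is not the knot of a divide.) -/
/-- A matrix in SL(2,ℤ) of trace 3 is not a product of two unipotent matrices
that are conjugate to each other in SL(2,ℤ). -/
theorem sl2z_trace_three_not_product_of_conjugate_unipotents
    (M : Matrix.SpecialLinearGroup (Fin 2) ℤ)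
    (hM : Matrix.trace (M : Matrix (Fin 2) (Fin 2) ℤ) = 3) :
    ¬ ∃ A B : Matrix.SpecialLinearGroup (Fin 2) ℤ,
        M = A * B ∧
        ((A : Matrix (Fin 2) (Fin 2) ℤ) - 1) ^ 2 = 0 ∧
        ((B : Matrix (Fin 2) (Fin 2) ℤ) - 1) ^ 2 = 0 ∧
        ∃ C : Matrix.SpecialLinearGroup (Fin 2) ℤ, B = C * A * C⁻¹ := by
  rintro ⟨A, B, hMAB, hA, -, C, hB⟩
  subst hB
  subst hMAB
  have dA := A.det_coe
  have dC := C.det_coe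
  simp only [Matrix.SpecialLinearGroup.coe_mul, Matrix.SpecialLinearGroup.coe_inv] at hM
  generalize (A : Matrix (Fin 2) (Fin 2) ℤ) = X at *
  generalize (C : Matrix (Fin 2) (Fin 2) ℤ) = Y at *
  rw [Matrix.det_fin_two] at dA dC
  have h00 := congrFun (congrFun hA 0) 0
  have h01 := congrFun (congrFun hA 0) 1
  have h10 := congrFun (congrFun hA 1) 0
  have h11 := congrFun (congrFun hA 1) 1
  simp [pow_two, Matrix.mul_apply, Fin.sum_univ_two] at h00 h01 h10 h11
  simp [Matrix.trace_fin_two, Matrix.mul_apply, Fin.sum_univ_two, Matrix.adjugate_fin_two] at hM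
  generalize X 0 0 = e at *
  generalize X 0 1 = f at *
  generalize X 1 0 = g at *
  generalize X 1 1 = h at *
  generalize Y 0 0 = a at *
  generalize Y 0 1 = b at *
  generalize Y 1 0 = c at *
  generalize Y 1 1 = d at *
  have k1 : e * (e + h - 2) = 0 := by linear_combination h00 + dA
  have k2 : f * (e + h - 2) = 0 := by linear_combination h01
  have ht : e + h - 2 = 0 := by
    by_contra hne
    have he : e = 0 := (mul_eq_zero.mp k1).resolve_right hne
    have hf : f = 0 := (mul_eq_zero.mp k2).resolve_right hne
    subst he hf
    simp at dA
  obtain rfl : h = 2 - e := by linarith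
  have key : ((e - 1) * (a - d) + f * c + g * b) ^ 2 = -1 := by
    have hn : (e - 1) ^ 2 + f * g = 0 := by linear_combination h00
    linear_combination (-1) * hM + ((a + d) ^ 2 - 2 * (a * d - b * c)) * hn + 2 * dC
  nlinarith [sq_nonneg ((e - 1) * (a - d) + f * c + g * b)]
end

section
/- Let A, B ∈ SL(2,ℤ) be unipotent matrices that are conjugate to each other in SL(2,ℤ). Then there exists an integer m such that the trace of A·B equals 2 − m²; in particular, the trace of A·B is at most 2. -/
/-- If A, B ∈ SL(2,ℤ) are unipotent and conjugate to each other in SL(2,ℤ),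
then trace (A·B) = 2 − m² for some integer m; in particular trace (A·B) ≤ 2. -/
theorem trace_mul_of_conjugate_unipotents_sl2z
    (A B : Matrix.SpecialLinearGroup (Fin 2) ℤ)
    (hA : ((A : Matrix (Fin 2) (Fin 2) ℤ) - 1) ^ 2 = 0)
    (hB : ((B : Matrix (Fin 2) (Fin 2) ℤ) - 1) ^ 2 = 0)
    (hconj : ∃ C : Matrix.SpecialLinearGroup (Fin 2) ℤ, B = C * A * C⁻¹) :
    (∃ m : ℤ, Matrix.trace ((A * B : Matrix.SpecialLinearGroup (Fin 2) ℤ) :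
        Matrix (Fin 2) (Fin 2) ℤ) = 2 - m ^ 2) ∧
    Matrix.trace ((A * B : Matrix.SpecialLinearGroup (Fin 2) ℤ) :
        Matrix (Fin 2) (Fin 2) ℤ) ≤ 2 := by
  obtain ⟨C, rfl⟩ := hconj
  have hC := C.det_coe
  rw [Matrix.det_fin_two] at hC
  suffices h : ∃ m : ℤ, Matrix.trace ((A * (C * A * C⁻¹) : Matrix.SpecialLinearGroup (Fin 2) ℤ) :
        Matrix (Fin 2) (Fin 2) ℤ) = 2 - m ^ 2 by
    refine ⟨h, ?_⟩
    obtain ⟨m, hm⟩ := h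
    rw [hm]
    nlinarith [sq_nonneg m]
  clear hB
  have h00 := congrFun (congrFun hA 0) 0
  have h01 := congrFun (congrFun hA 0) 1
  have h10 := congrFun (congrFun hA 1) 0
  have h11 := congrFun (congrFun hA 1) 1
  simp [pow_two, Matrix.mul_apply, Fin.sum_univ_two] at h00 h01 h10 h11
  simp only [Matrix.SpecialLinearGroup.coe_mul, Matrix.SpecialLinearGroup.coe_inv,
    Matrix.adjugate_fin_two, Matrix.trace_fin_two, Matrix.mul_apply, Fin.sum_univ_two]
  simp only [Matrix.of_apply, Matrix.cons_val', Matrix.cons_val_zero, Matrix.cons_val_one,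
    Matrix.cons_val_fin_one]
  generalize (A : Matrix (Fin 2) (Fin 2) ℤ) 0 0 = a at *
  generalize (A : Matrix (Fin 2) (Fin 2) ℤ) 0 1 = b at *
  generalize (A : Matrix (Fin 2) (Fin 2) ℤ) 1 0 = c at *
  generalize (A : Matrix (Fin 2) (Fin 2) ℤ) 1 1 = d at *
  generalize (C : Matrix (Fin 2) (Fin 2) ℤ) 0 0 = p at *
  generalize (C : Matrix (Fin 2) (Fin 2) ℤ) 0 1 = q at *
  generalize (C : Matrix (Fin 2) (Fin 2) ℤ) 1 0 = r at *
  generalize (C : Matrix (Fin 2) (Fin 2) ℤ) 1 1 = s at *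
  have ht : d = 2 - a := by
    by_contra hne
    have hne' : a + d - 2 ≠ 0 := fun h => hne (by linarith)
    have hb : b = 0 := (mul_eq_zero.mp (show b * (a + d - 2) = 0 by linarith)).resolve_right hne'
    subst hb
    have ha : a - 1 = 0 := mul_self_eq_zero.mp (by linarith)
    have hd : d - 1 = 0 := mul_self_eq_zero.mp (by linarith)
    exact hne (by linarith)
  subst ht
  refine ⟨(a - 1) * p + b * r + c * q - (a - 1) * s, ?_⟩
  linear_combination ((p + s) ^ 2 - 2 * (p * s - q * r)) * h00 + 2 * hC
end

section
/- Let M and N be 2×2 integer matrices with M·M = 0, and suppose N = C·M·C⁻¹ for some C ∈ SL(2,ℤ) (equivalently, N·C = C·M for a 2×2 integer matrix C of determinant 1). Then there exists an integer m such that the trace of M·N equals −m²; in particular, trace(M·N) ≤ 0. -/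
/-- If M is a 2×2 integer matrix with M·M = 0 and N is conjugate to M by a
matrix C of determinant 1 (i.e. N·C = C·M), then trace (M·N) = −m² for some
integer m; in particular trace (M·N) ≤ 0. -/
theorem trace_mul_conj_of_sq_zero
    (M N C : Matrix (Fin 2) (Fin 2) ℤ)
    (hM : M * M = 0)
    (hC : C.det = 1)
    (hN : N * C = C * M) :
    (∃ m : ℤ, Matrix.trace (M * N) = -m ^ 2) ∧ Matrix.trace (M * N) ≤ 0 := by
  have key : Matrix.trace (M * N) = -(Matrix.trace (M * C)) ^ 2 := by
    have hN' : N = C * M * C.adjugate := by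
      rw [← hN, Matrix.mul_assoc, Matrix.mul_adjugate, hC, one_smul, Matrix.mul_one]
    have h00 := congrFun (congrFun hM 0) 0
    have h01 := congrFun (congrFun hM 0) 1
    have h10 := congrFun (congrFun hM 1) 0
    have h11 := congrFun (congrFun hM 1) 1
    simp only [Matrix.mul_apply, Fin.sum_univ_two, Matrix.zero_apply] at h00 h01 h10 h11
    have htr : M 1 1 = - M 0 0 := by
      by_contra hne
      have hs : M 0 0 + M 1 1 ≠ 0 := fun h => hne (by linarith)
      have hb : M 0 1 = 0 := by
        have : M 0 1 * (M 0 0 + M 1 1) = 0 := by linarith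
        exact (mul_eq_zero.mp this).resolve_right hs
      rw [hb] at h00 h11
      have ha : M 0 0 = 0 := by simpa using h00
      have hd : M 1 1 = 0 := by simpa using h11
      exact hs (by rw [ha, hd]; rfl)
    rw [hN', Matrix.adjugate_fin_two]
    simp only [Matrix.trace_fin_two, Matrix.mul_apply, Fin.sum_univ_two, Matrix.of_apply,
      Matrix.cons_val_zero, Matrix.cons_val_one, Matrix.cons_val', Matrix.cons_val_fin_one]
    rw [htr]
    generalize M 0 0 = a at *
    generalize M 0 1 = b at *
    generalize M 1 0 = c at *
    generalize C 0 0 = p at *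
    generalize C 0 1 = q at *
    generalize C 1 0 = r at *
    generalize C 1 1 = s at *
    clear hN hN' hC hM
    grind
  refine ⟨⟨_, key⟩, ?_⟩
  rw [key]
  have := sq_nonneg (Matrix.trace (M * C))
  linarith
end

section
/- Let γ : [0,1] → ℝ² be a C¹ map with γ'(t) ≠ 0 for all t, with ‖γ(0)‖ = ‖γ(1)‖ = 1, γ(0) ≠ γ(1), ‖γ(t)‖ < 1 for all t ∈ (0,1), and such that whenever γ(s) = γ(t) with s ≠ t, the velocity vectors γ'(s) and γ'(t) are linearly independent (i.e., γ is a generic relative immersion of the interval in the unit disk: a one-branch divide). Define δ : [−1,1] → ℝ² × ℝ² by δ(t) = (γ(|t|), sign(t)·√(1 − ‖γ(|t|)‖²)·γ'(|t|)/‖γ'(|t|)‖), where sign(0) = 0. Then δ is continuous, δ(−1) = δ(1), δ is injective on [−1,1), and the image of δ equals L(γ). Consequently L(γ) is a topologically embedded circle (a classical knot) in the unit 3-sphere {(x,u) ∈ ℝ²×ℝ² : ‖x‖² + ‖u‖² = 1} of ℝ⁴. -/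
open Set

/-- The link of a one-branch divide `γ` (with velocity field `γ'`): all unit
tangent vectors `(x, u)` of ℝ² with foot `x = γ t` on the branch and linear
part `u` tangent to the branch at `x`. -/
noncomputable def divideLink (γ γ' : ℝ → EuclideanSpace ℝ (Fin 2)) :
    Set (EuclideanSpace ℝ (Fin 2) × EuclideanSpace ℝ (Fin 2)) :=
  {p | ∃ t ∈ Icc (0 : ℝ) 1, p.1 = γ t ∧ (∃ c : ℝ, p.2 = c • γ' t) ∧
    ‖p.1‖ ^ 2 + ‖p.2‖ ^ 2 = 1}

/-- The parametrization `δ` of the link of a one-branch divide. -/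
noncomputable def divideLinkParam (γ γ' : ℝ → EuclideanSpace ℝ (Fin 2)) :
    ℝ → EuclideanSpace ℝ (Fin 2) × EuclideanSpace ℝ (Fin 2) :=
  fun t => (γ |t|,
    (Real.sign t * Real.sqrt (1 - ‖γ |t|‖ ^ 2) / ‖γ' |t|‖) • γ' |t|)

/-- The link of a one-branch divide is a topologically embedded circle (a
classical knot) in the unit 3-sphere of ℝ⁴, parametrized by `δ`. -/
theorem divideLink_is_knot
    (γ γ' : ℝ → EuclideanSpace ℝ (Fin 2))
    (hderiv : ∀ t ∈ Icc (0 : ℝ) 1, HasDerivAt γ (γ' t) t)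
    (hC1 : ContinuousOn γ' (Icc (0 : ℝ) 1))
    (hreg : ∀ t ∈ Icc (0 : ℝ) 1, γ' t ≠ 0)
    (h0 : ‖γ 0‖ = 1) (h1 : ‖γ 1‖ = 1) (hends : γ 0 ≠ γ 1)
    (hint : ∀ t ∈ Ioo (0 : ℝ) 1, ‖γ t‖ < 1)
    (hgen : ∀ s ∈ Icc (0 : ℝ) 1, ∀ t ∈ Icc (0 : ℝ) 1, s ≠ t → γ s = γ t →
      LinearIndependent ℝ ![γ' s, γ' t]) :
    ContinuousOn (divideLinkParam γ γ') (Icc (-1 : ℝ) 1) ∧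
    divideLinkParam γ γ' (-1) = divideLinkParam γ γ' 1 ∧
    InjOn (divideLinkParam γ γ') (Ico (-1 : ℝ) 1) ∧
    divideLinkParam γ γ' '' Icc (-1 : ℝ) 1 = divideLink γ γ' ∧
    (∀ p ∈ divideLink γ γ', ‖p.1‖ ^ 2 + ‖p.2‖ ^ 2 = 1) ∧
    Nonempty (Circle ≃ₜ (divideLink γ γ')) := by
  have habs : ∀ t ∈ Icc (-1 : ℝ) 1, |t| ∈ Icc (0 : ℝ) 1 := fun t ht =>
    ⟨abs_nonneg t, abs_le.2 ht⟩
  have hle : ∀ t ∈ Icc (0 : ℝ) 1, ‖γ t‖ ≤ 1 := by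
    intro t ht
    rcases eq_or_lt_of_le ht.1 with h | h
    · rw [← h, h0]
    rcases eq_or_lt_of_le ht.2 with h' | h'
    · rw [h', h1]
    exact (hint t ⟨h, h'⟩).le
  have hsq0 : ∀ t ∈ Icc (0 : ℝ) 1, Real.sqrt (1 - ‖γ t‖ ^ 2) = 0 → t = 0 ∨ t = 1 := by
    intro t ht h
    by_contra! hne
    have hlt := hint t ⟨lt_of_le_of_ne ht.1 (Ne.symm hne.1), lt_of_le_of_ne ht.2 hne.2⟩
    have hpos : 0 < 1 - ‖γ t‖ ^ 2 := by nlinarith [norm_nonneg (γ t)]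
    exact (Real.sqrt_pos.2 hpos).ne' h
  have hs0 : Real.sqrt (1 - ‖γ 0‖ ^ 2) = 0 := by simp [h0]
  have hs1 : Real.sqrt (1 - ‖γ 1‖ ^ 2) = 0 := by simp [h1]
  have hcont : ContinuousOn (divideLinkParam γ γ') (Icc (-1 : ℝ) 1) := by
    have hγ : ContinuousOn γ (Icc (0 : ℝ) 1) := fun t ht =>
      (hderiv t ht).continuousAt.continuousWithinAt
    have hγa : ContinuousOn (fun t : ℝ => γ |t|) (Icc (-1 : ℝ) 1) :=
      hγ.comp continuous_abs.continuousOn habs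
    have hγa' : ContinuousOn (fun t : ℝ => γ' |t|) (Icc (-1 : ℝ) 1) :=
      hC1.comp continuous_abs.continuousOn habs
    have hw : ContinuousOn (fun t : ℝ =>
        (Real.sqrt (1 - ‖γ |t|‖ ^ 2) / ‖γ' |t|‖) • γ' |t|) (Icc (-1 : ℝ) 1) := by
      refine ContinuousOn.smul (ContinuousOn.div ?_ hγa'.norm ?_) hγa'
      · exact (continuousOn_const.sub (hγa.norm.pow 2)).sqrt
      · intro t ht
        exact norm_ne_zero_iff.2 (hreg _ (habs t ht))
    refine hγa.prodMk ?_
    have hU : Icc (-1 : ℝ) 1 = Icc (-1 : ℝ) 0 ∪ Icc 0 1 :=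
      (Icc_union_Icc_eq_Icc (by norm_num) (by norm_num)).symm
    rw [hU]
    refine ContinuousOn.union_of_isClosed ?_ ?_ isClosed_Icc isClosed_Icc
    · refine (hw.neg.mono (Icc_subset_Icc_right (by norm_num))).congr ?_
      intro t ht
      rcases eq_or_lt_of_le ht.2 with h | h
      · simp [h, h0]
      · simp [Real.sign_of_neg h, neg_div]
    · refine (hw.mono (Icc_subset_Icc_left (by norm_num))).congr ?_
      intro t ht
      rcases eq_or_lt_of_le ht.1 with h | h
      · simp [← h, h0]
      · simp [Real.sign_of_pos h]
  have hper : divideLinkParam γ γ' (-1) = divideLinkParam γ γ' 1 := by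
    simp [divideLinkParam, h1]
  have hinj : InjOn (divideLinkParam γ γ') (Ico (-1 : ℝ) 1) := by
    intro s hs t ht hst
    have hs' := habs s (Ico_subset_Icc_self hs)
    have ht' := habs t (Ico_subset_Icc_self ht)
    have e1 : γ |s| = γ |t| := congrArg Prod.fst hst
    have e2 : (Real.sign s * Real.sqrt (1 - ‖γ |s|‖ ^ 2) / ‖γ' |s|‖) • γ' |s| =
      (Real.sign t * Real.sqrt (1 - ‖γ |t|‖ ^ 2) / ‖γ' |t|‖) • γ' |t| :=
      congrArg Prod.snd hst
    have sgn0 : ∀ r : ℝ, |r| ∈ Icc (0 : ℝ) 1 →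
        Real.sign r * Real.sqrt (1 - ‖γ |r|‖ ^ 2) / ‖γ' |r|‖ = 0 → |r| = 0 ∨ |r| = 1 := by
      intro r hr h
      rcases div_eq_zero_iff.1 h with h | h
      · rcases mul_eq_zero.1 h with h | h
        · left
          rw [Real.sign_eq_zero_iff.1 h, abs_zero]
        · exact hsq0 _ hr h
      · exact absurd (norm_eq_zero.1 h) (hreg _ hr)
    by_cases hab : |s| = |t|
    · rcases abs_eq_abs.1 hab with h | h
      · exact h
      · by_cases hz : s = 0
        · rw [hz] at h ⊢; linarith
        exfalso
        rw [hab] at e2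
        have hc := smul_left_injective ℝ (hreg _ ht') e2
        have hneg : Real.sign s = - Real.sign t := by
          rw [h]
          rcases lt_trichotomy t 0 with h | h | h
          · rw [Real.sign_of_neg h, Real.sign_of_pos (by linarith)]; norm_num
          · simp [h]
          · rw [Real.sign_of_pos h, Real.sign_of_neg (by linarith)]
        have hc0 : Real.sign t * Real.sqrt (1 - ‖γ |t|‖ ^ 2) / ‖γ' |t|‖ = 0 := by
          simp only [hneg, neg_mul, neg_div] at hc
          linarith
        rcases sgn0 t ht' hc0 with h' | h'
        · rw [abs_eq_zero] at h'
          exact hz (by rw [h, h', neg_zero])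
        · rcases abs_eq (by norm_num : (0:ℝ) ≤ 1) |>.1 h' with h'' | h''
          · linarith [ht.2]
          · linarith [hs.2]
    · exfalso
      have hli := LinearIndependent.pair_iff.1 (hgen _ hs' _ ht' hab e1)
      have := hli _ (-(Real.sign t * Real.sqrt (1 - ‖γ |t|‖ ^ 2) / ‖γ' |t|‖))
        (by rw [e2, neg_smul]; exact add_neg_cancel _)
      have a1 := sgn0 s hs' this.1
      have a2 := sgn0 t ht' (neg_eq_zero.1 this.2)
      rcases a1 with a1 | a1 <;> rcases a2 with a2 | a2
      · exact hab (a1.trans a2.symm)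
      · rw [a1, a2] at e1; exact hends e1
      · rw [a1, a2] at e1; exact hends e1.symm
      · exact hab (a1.trans a2.symm)
  have himg : divideLinkParam γ γ' '' Icc (-1 : ℝ) 1 = divideLink γ γ' := by
    apply Subset.antisymm
    · rintro _ ⟨t, ht, rfl⟩
      have ht' := habs t ht
      refine ⟨|t|, ht', rfl, ⟨_, rfl⟩, ?_⟩
      have hn : ‖γ' |t|‖ ≠ 0 := norm_ne_zero_iff.2 (hreg _ ht')
      have hnn : 0 ≤ 1 - ‖γ |t|‖ ^ 2 := by nlinarith [norm_nonneg (γ |t|), hle _ ht']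
      have key : Real.sign t ^ 2 * (1 - ‖γ |t|‖ ^ 2) = 1 - ‖γ |t|‖ ^ 2 := by
        rcases lt_trichotomy t 0 with h | h | h
        · rw [Real.sign_of_neg h]; norm_num
        · simp [h, h0]
        · rw [Real.sign_of_pos h]; norm_num
      simp only [divideLinkParam, norm_smul, mul_pow, norm_div, div_pow, norm_mul,
        Real.norm_eq_abs, sq_abs, Real.sq_sqrt hnn, key]
      rw [div_mul_cancel₀ _ (pow_ne_zero 2 hn)]
      ring
    · rintro ⟨x, u⟩ ⟨t, ht, hx, ⟨c, hu⟩, hxu⟩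
      simp only at hx hu hxu
      subst hx hu
      have hn : 0 < ‖γ' t‖ := norm_pos_iff.2 (hreg _ ht)
      have hsqrt : Real.sqrt (1 - ‖γ t‖ ^ 2) = |c| * ‖γ' t‖ := by
        have : 1 - ‖γ t‖ ^ 2 = (|c| * ‖γ' t‖) ^ 2 := by
          rw [norm_smul, Real.norm_eq_abs] at hxu
          linarith
        rw [this, Real.sqrt_sq (by positivity)]
      rcases eq_or_lt_of_le ht.1 with h | h
      · refine ⟨0, by norm_num, ?_⟩
        subst h
        rw [hs0] at hsqrt
        have hc : c = 0 := by
          rcases mul_eq_zero.1 hsqrt.symm with h | h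
          · exact abs_eq_zero.1 h
          · exact absurd h hn.ne'
        simp [divideLinkParam, hc]
      rcases le_total 0 c with hc | hc
      · refine ⟨t, ⟨by linarith, ht.2⟩, ?_⟩
        simp only [divideLinkParam, abs_of_pos h, hsqrt, Real.sign_of_pos h, abs_of_nonneg hc]
        rw [one_mul, mul_div_cancel_right₀ _ hn.ne']
      · refine ⟨-t, ⟨by linarith [ht.2], by linarith⟩, ?_⟩
        have hneg : -t < 0 := by linarith
        simp only [divideLinkParam, abs_neg, abs_of_pos h, hsqrt, Real.sign_of_neg hneg,
          abs_of_nonpos hc]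
        rw [← mul_assoc, mul_div_cancel_right₀ _ hn.ne']
        simp
  refine ⟨hcont, hper, hinj, himg, fun p ⟨_, _, _, _, h⟩ => h, ?_⟩
  have : Fact ((0 : ℝ) < 2) := ⟨by norm_num⟩
  have e12 : (-1 : ℝ) + 2 = 1 := by norm_num
  let F : AddCircle (2 : ℝ) → EuclideanSpace ℝ (Fin 2) × EuclideanSpace ℝ (Fin 2) :=
    AddCircle.liftIco 2 (-1) (divideLinkParam γ γ')
  have hF : Continuous F :=
    AddCircle.liftIco_continuous (by rw [e12]; exact hper) (by rw [e12]; exact hcont)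
  have hFv : ∀ z, F z = divideLinkParam γ γ' (AddCircle.equivIco 2 (-1) z) := fun z => rfl
  have hIco : ∀ z, ((AddCircle.equivIco (2 : ℝ) (-1) z : Ico (-1 : ℝ) (-1 + 2)) : ℝ) ∈
      Ico (-1 : ℝ) 1 := by
    intro z
    have := (AddCircle.equivIco (2 : ℝ) (-1) z).2
    exact ⟨this.1, this.2.trans_eq e12⟩
  have hmem : ∀ z, F z ∈ divideLink γ γ' := by
    intro z
    rw [← himg, hFv]
    exact mem_image_of_mem _ (Ico_subset_Icc_self (hIco z))
  let G : AddCircle (2 : ℝ) → divideLink γ γ' := fun z => ⟨F z, hmem z⟩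
  have hG : Continuous G := hF.subtype_mk _
  have hGb : Function.Bijective G := by
    constructor
    · intro a b hab
      have h : F a = F b := congrArg Subtype.val hab
      rw [hFv, hFv] at h
      exact (AddCircle.equivIco (2 : ℝ) (-1)).injective
        (Subtype.ext (hinj (hIco a) (hIco b) h))
    · rintro ⟨p, hp⟩
      have hp' := hp
      rw [← himg] at hp'
      obtain ⟨t, ht, rfl⟩ := hp'
      have hex : ∃ r ∈ Ico (-1 : ℝ) 1, divideLinkParam γ γ' r = divideLinkParam γ γ' t := by
        rcases eq_or_lt_of_le ht.2 with h | h
        · exact ⟨-1, by norm_num, by rw [h, hper]⟩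
        · exact ⟨t, ⟨ht.1, h⟩, rfl⟩
      obtain ⟨r, hr, hrt⟩ := hex
      refine ⟨(r : AddCircle (2 : ℝ)), Subtype.ext ?_⟩
      exact (AddCircle.liftIco_coe_apply (by rw [e12]; exact hr)).trans hrt
  have hE : Continuous (Equiv.ofBijective G hGb) := hG
  exact ⟨(AddCircle.homeomorphCircle (T := (2 : ℝ)) (by norm_num)).symm.trans
    hE.homeoOfEquivCompactToT2⟩
end

section
/- Let γ₁, γ₂ : [0,1] → ℝ² be differentiable curves such that whenever γ₁(s) = γ₂(t) for some s, t ∈ [0,1], one has ‖γ₁(s)‖ < 1 and the velocity vectors γ₁'(s) and γ₂'(t) are linearly independent (i.e., the two branches intersect only transversally in the open unit disk). Then the links L(γ₁) and L(γ₂) are disjoint subsets of the unit 3-sphere of ℝ⁴. (This is the statement that the link of a divide with several branches is a disjoint union of the links of its branches.) -/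
open Set

/-- If two branches of a divide meet only transversally in the open unit disk,
then their links are disjoint subsets of the unit 3-sphere of ℝ⁴. -/
theorem divideLink_disjoint_of_transversal
    (γ₁ γ₂ γ₁' γ₂' : ℝ → EuclideanSpace ℝ (Fin 2))
    (hd₁ : ∀ t ∈ Icc (0 : ℝ) 1, HasDerivAt γ₁ (γ₁' t) t)
    (hd₂ : ∀ t ∈ Icc (0 : ℝ) 1, HasDerivAt γ₂ (γ₂' t) t)
    (htrans : ∀ s ∈ Icc (0 : ℝ) 1, ∀ t ∈ Icc (0 : ℝ) 1, γ₁ s = γ₂ t →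
      ‖γ₁ s‖ < 1 ∧ LinearIndependent ℝ ![γ₁' s, γ₂' t]) :
    Disjoint (divideLink γ₁ γ₁') (divideLink γ₂ γ₂') := by
  rw [Set.disjoint_left]
  rintro ⟨x, u⟩ ⟨s, hs, hx, ⟨a, ha⟩, hn⟩ ⟨t, ht, hy, ⟨b, hb⟩, -⟩
  simp only at hx ha hn hy hb
  obtain ⟨hlt, hli⟩ := htrans s hs t ht (hx.symm.trans hy)
  rw [LinearIndependent.pair_iff] at hli
  have h := hli a (-b) (by rw [neg_smul, ← ha, ← hb, add_neg_cancel])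
  have hu : u = 0 := by rw [ha, h.1, zero_smul]
  rw [← hx] at hlt
  rw [hu, norm_zero] at hn
  nlinarith [norm_nonneg x]
end

section
/- Let a, b : ℝ → ℝ be twice differentiable functions with a(t)² + b(t)² + a'(t)² + b'(t)² = 1 for all t, and let Γ : ℝ → ℍ be the curve of quaternions Γ(t) := a(t) − a'(t)·i + b(t)·j + b'(t)·k. Then ‖Γ(t)‖ = 1 for all t, and the left invariant velocity v(t) := Γ(t)⁻¹ · Γ'(t) (where Γ'(t) is the componentwise derivative of Γ) has real part equal to 0 and i-component equal to a'(t)² + b'(t)² − a(t)a''(t) − b(t)b''(t). -/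
open scoped Quaternion

/-- The quaternionic lift `t ↦ a(t) − a'(t)·i + b(t)·j + b'(t)·k` of a plane
curve `(a, b)` with velocity `(a', b')`. Applying it to `(a', a'', b', b'')`
gives the componentwise derivative of the lift of `(a, a', b, b')`. -/
noncomputable def quatLift (a a' b b' : ℝ → ℝ) : ℝ → ℍ[ℝ] :=
  fun t => ⟨a t, -(a' t), b t, b' t⟩

/-- For a plane curve `(a, b)` whose tangent lift lies on the unit sphere of
ℝ⁴, the quaternionic lift `Γ(t) = a − a'i + bj + b'k` has norm 1, and the left
invariant velocity `v = Γ⁻¹·Γ'` has real part 0 and i-component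
`a'² + b'² − a·a'' − b·b''`. -/
theorem quatLift_leftInvariantVelocity
    (a b a' b' a'' b'' : ℝ → ℝ)
    (ha : ∀ t, HasDerivAt a (a' t) t)
    (hb : ∀ t, HasDerivAt b (b' t) t)
    (ha' : ∀ t, HasDerivAt a' (a'' t) t)
    (hb' : ∀ t, HasDerivAt b' (b'' t) t)
    (hnorm : ∀ t, a t ^ 2 + b t ^ 2 + a' t ^ 2 + b' t ^ 2 = 1)
    (t : ℝ) :
    ‖quatLift a a' b b' t‖ = 1 ∧
    ((quatLift a a' b b' t)⁻¹ * quatLift a' a'' b' b'' t).re = 0 ∧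
    ((quatLift a a' b b' t)⁻¹ * quatLift a' a'' b' b'' t).imI =
      a' t ^ 2 + b' t ^ 2 - a t * a'' t - b t * b'' t := by
  have hn : Quaternion.normSq (quatLift a a' b b' t) = 1 := by
    rw [Quaternion.normSq_def']
    simp only [quatLift]
    linarith [hnorm t, neg_sq (a' t)]
  have hd : a t * a' t + b t * b' t + a' t * a'' t + b' t * b'' t = 0 := by
    have h1 := ((((ha t).pow 2).add ((hb t).pow 2)).add ((ha' t).pow 2)).add ((hb' t).pow 2)
    have h2 : (((a ^ 2 + b ^ 2) + a' ^ 2) + b' ^ 2) = fun _ => (1 : ℝ) := by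
      funext s
      exact hnorm s
    rw [h2] at h1
    have h3 := h1.unique (hasDerivAt_const t (1 : ℝ))
    norm_num at h3
    linarith
  have hinv : (quatLift a a' b b' t)⁻¹ = star (quatLift a a' b b' t) := by
    rw [Quaternion.inv_def, hn, inv_one, one_smul]
  refine ⟨?_, ?_, ?_⟩
  · have h := Quaternion.normSq_eq_norm_mul_self (quatLift a a' b b' t)
    rw [hn] at h
    nlinarith [norm_nonneg (quatLift a a' b b' t)]
  · rw [hinv, Quaternion.re_mul]
    simp only [Quaternion.re_star, Quaternion.imI_star, Quaternion.imJ_star,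
      Quaternion.imK_star]
    simp only [quatLift]
    linarith
  · rw [hinv, Quaternion.imI_mul]
    simp only [Quaternion.re_star, Quaternion.imI_star, Quaternion.imJ_star,
      Quaternion.imK_star]
    simp only [quatLift]
    ring
end

section
/- Let a, b : ℝ → ℝ be twice differentiable functions with a(t)² + b(t)² + a'(t)² + b'(t)² = 1 for all t, and let Γ : ℝ → ℍ be the curve of quaternions Γ(t) := a(t) − a'(t)·i + b(t)·j + b'(t)·k. Fix t and assume a'(t)² + b'(t)² − a(t)a''(t) − b(t)b''(t) ≠ 0. Then the velocity vector Γ'(t) does not lie in the real span of the two quaternions Γ(t)·j and Γ(t)·k. (This is the statement that the lifted curve is transversal to the left invariant contact structure on the unit sphere of the quaternions, which is given at each unit quaternion q by the plane spanned by q·j and q·k.) -/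
open scoped Quaternion

/-- The quaternion `j`. -/
def quatJ : ℍ[ℝ] := ⟨0, 0, 1, 0⟩

/-- The quaternion `k`. -/
def quatK : ℍ[ℝ] := ⟨0, 0, 0, 1⟩

/-- If the i-component `a'² + b'² − a·a'' − b·b''` of the left invariant
velocity is nonzero at `t`, then the velocity `Γ'(t)` of the quaternionic lift
`Γ = a − a'i + bj + b'k` does not lie in the real span of `Γ(t)·j` and
`Γ(t)·k`, i.e. the lift is transversal to the left invariant contact structure
on the unit sphere of the quaternions. -/
theorem quatLift_transversal_contact
    (a b a' b' a'' b'' : ℝ → ℝ)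
    (ha : ∀ t, HasDerivAt a (a' t) t)
    (hb : ∀ t, HasDerivAt b (b' t) t)
    (ha' : ∀ t, HasDerivAt a' (a'' t) t)
    (hb' : ∀ t, HasDerivAt b' (b'' t) t)
    (hnorm : ∀ t, a t ^ 2 + b t ^ 2 + a' t ^ 2 + b' t ^ 2 = 1)
    (t : ℝ)
    (hvi : a' t ^ 2 + b' t ^ 2 - a t * a'' t - b t * b'' t ≠ 0) :
    quatLift a' a'' b' b'' t ∉
      Submodule.span ℝ
        ({quatLift a a' b b' t * quatJ, quatLift a a' b b' t * quatK} :
          Set ℍ[ℝ]) := by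
  intro h
  obtain ⟨x, y, hxy⟩ := Submodule.mem_span_pair.mp h
  have h0 := congrArg QuaternionAlgebra.re hxy
  have h1 := congrArg QuaternionAlgebra.imI hxy
  have h2 := congrArg QuaternionAlgebra.imJ hxy
  have h3 := congrArg QuaternionAlgebra.imK hxy
  simp only [Quaternion.re_add, Quaternion.imI_add, Quaternion.imJ_add, Quaternion.imK_add,
    Quaternion.re_smul, Quaternion.imI_smul, Quaternion.imJ_smul, Quaternion.imK_smul,
    Quaternion.re_mul, Quaternion.imI_mul, Quaternion.imJ_mul, Quaternion.imK_mul,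
    smul_eq_mul] at h0 h1 h2 h3
  simp only [quatLift, quatJ, quatK] at h0 h1 h2 h3
  apply hvi
  linear_combination (-a' t) * h0 - a t * h1 - b' t * h2 + b t * h3
end
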